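/- Fix a positive integer d, a partition λ = (λ_1, …, λ_ℓ) of d, an integer a, and finitely supported functions n : {1,2,3,…} → ℕ and e : {1,2,3,…} → ℕ. For a partition μ of d, let FS^h(μ; a', n, e) denote the sum of 1/|Aut(M)| over equivalence classes of fully simple hypermaps M with ℓ(μ) boundary faces of degrees μ_1, …, μ_{ℓ(μ)}, with −χ(M) = a', with n(i) internal faces of degree i and e(i) hyperedges of degree i for every i ≥ 1; let Ord^h(λ; a, n, e) denote the analogous sum over equivalence classes of all hypermaps with boundary face degrees λ_1, …, λ_ℓ. Then Ord^h(λ; a, n, e) = z(λ) · Σ_{μ ⊢ d} Σ_{k ≥ 0} H^<_k(λ; μ) · FS^h(μ; a − k, n, e), where the inner sum has only finitely many nonzero terms. -/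

import Mathlib

open Equiv

namespace FSM

/-- The number of cycles of a permutation (counting fixed points), i.e. the number of
orbits, realised as the cardinality of the quotient of the underlying set by the
`SameCycle` relation. -/
noncomputable def cycleCount {α : Type*} (σ : Perm α) : ℕ :=
  Nat.card (Quot σ.SameCycle)

/-- The size of the cycle (orbit) of `σ` containing `x`, counting fixed points as
cycles of length `1`. -/
noncomputable def orbitSize {α : Type*} (σ : Perm α) (x : α) : ℕ :=
  Nat.card {y : α // σ.SameCycle x y}

/-- The cycle type of a permutation including parts equal to `1` for the fixed points. -/
noncomputable def fullCycleType {α : Type*} [Fintype α] [DecidableEq α] (σ : Perm α) :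
    Multiset ℕ :=
  σ.cycleType + Multiset.replicate (Fintype.card α - σ.support.card) 1

/-- A list of permutations is a strictly monotone sequence of transpositions if each
entry is a transposition `(aᵢ bᵢ)` with `aᵢ < bᵢ` and the sequence `b₁, b₂, …` is
strictly increasing. -/
def IsStrictlyMonotone {d : ℕ} (l : List (Perm (Fin d))) : Prop :=
  ∃ ab : List (Fin d × Fin d),
    l = ab.map (fun p => Equiv.swap p.1 p.2) ∧
    (∀ p ∈ ab, p.1 < p.2) ∧
    List.Chain' (· < ·) (ab.map Prod.snd)

/-- A list of permutations is a weakly monotone sequence of transpositions if each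
entry is a transposition `(aᵢ bᵢ)` with `aᵢ < bᵢ` and the sequence `b₁, b₂, …` is
weakly increasing. -/
def IsWeaklyMonotone {d : ℕ} (l : List (Perm (Fin d))) : Prop :=
  ∃ ab : List (Fin d × Fin d),
    l = ab.map (fun p => Equiv.swap p.1 p.2) ∧
    (∀ p ∈ ab, p.1 < p.2) ∧
    List.Chain' (· ≤ ·) (ab.map Prod.snd)

/-- The strictly monotone Hurwitz number `H^<_k(λ; μ)`: `1/d!` times the number of
tuples `(ρ_λ, τ₁, …, τ_k, ρ_μ)` with `ρ_λ` of cycle type `λ`, `ρ_μ` of cycle type `μ`,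
`τ₁, …, τ_k` a strictly monotone sequence of transpositions and
`ρ_λ τ₁ ⋯ τ_k ρ_μ = id`. -/
noncomputable def Hstrict (d k : ℕ) (lam mu : Nat.Partition d) : ℚ :=
  (Nat.card {t : Perm (Fin d) × List (Perm (Fin d)) × Perm (Fin d) //
      fullCycleType t.1 = lam.parts ∧ fullCycleType t.2.2 = mu.parts ∧
      t.2.1.length = k ∧ IsStrictlyMonotone t.2.1 ∧
      t.1 * t.2.1.prod * t.2.2 = 1} : ℚ) / (d.factorial : ℚ)

/-- The weakly monotone Hurwitz number `H^≤_k(λ; μ)`. -/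
noncomputable def Hweak (d k : ℕ) (lam mu : Nat.Partition d) : ℚ :=
  (Nat.card {t : Perm (Fin d) × List (Perm (Fin d)) × Perm (Fin d) //
      fullCycleType t.1 = lam.parts ∧ fullCycleType t.2.2 = mu.parts ∧
      t.2.1.length = k ∧ IsWeaklyMonotone t.2.1 ∧
      t.1 * t.2.1.prod * t.2.2 = 1} : ℚ) / (d.factorial : ℚ)

/-- `z(λ) = ∏ᵢ λᵢ · ∏ⱼ mⱼ(λ)!`. -/
def zPart {d : ℕ} (lam : Nat.Partition d) : ℕ :=
  lam.parts.prod * ∏ j ∈ lam.parts.toFinset, (lam.parts.count j).factorial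

end FSM
namespace FSM

/-- The permutation model of a hypermap with `n` (ordered, rooted) boundary faces on
the set `Fin m` of edges: `s0 s1 s2 = id` and no two roots lie in the same cycle of
`s2`.  The cycles of `s0` are the vertices, the cycles of `s1` are the hyperedges, and
the cycles of `s2` are the blue faces. -/
structure HMapData (m n : ℕ) where
  s0 : Perm (Fin m)
  s1 : Perm (Fin m)
  s2 : Perm (Fin m)
  R : Fin n → Fin m
  rel : s0 * s1 * s2 = 1
  roots_distinct : ∀ i j, s2.SameCycle (R i) (R j) → i = j

namespace HMapData

variable {m n : ℕ}

/-- The list of degrees of the boundary faces. -/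
noncomputable def boundaryDegrees (M : HMapData m n) : List ℕ :=
  List.ofFn fun i => orbitSize M.s2 (M.R i)

/-- The number of internal faces (cycles of `s2` containing no root) of degree `i`. -/
noncomputable def internalCount (M : HMapData m n) (i : ℕ) : ℕ :=
  Nat.card {q : Quot M.s2.SameCycle //
    orbitSize M.s2 q.out = i ∧ ∀ j, ¬ M.s2.SameCycle (M.R j) q.out}

/-- The number of hyperedges (cycles of `s1`) of degree `i`. -/
noncomputable def hyperedgeCount (M : HMapData m n) (i : ℕ) : ℕ :=
  Nat.card {q : Quot M.s1.SameCycle // orbitSize M.s1 q.out = i}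

/-- The Euler characteristic of the hypermap, with the interiors of the boundary faces
removed: `χ = c(σ₀) - |E| + c(σ₁) + c(σ₂) - n`. -/
noncomputable def eulerChar (M : HMapData m n) : ℤ :=
  (cycleCount M.s0 : ℤ) - m + cycleCount M.s1 + cycleCount M.s2 - n

/-- A hypermap is fully simple if no two boundary edges lie in the same cycle of `s0`. -/
def FullySimple (M : HMapData m n) : Prop :=
  ∀ x y : Fin m, (∃ i, M.s2.SameCycle (M.R i) x) → (∃ i, M.s2.SameCycle (M.R i) y) →
    M.s0.SameCycle x y → x = y

end HMapData

/-- Equivalence of hypermaps. -/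
def HMapEquivRel {m n : ℕ} (M M' : HMapData m n) : Prop :=
  ∃ φ : Perm (Fin m),
    φ * M.s0 * φ⁻¹ = M'.s0 ∧ φ * M.s1 * φ⁻¹ = M'.s1 ∧ φ * M.s2 * φ⁻¹ = M'.s2 ∧
    ∀ i, φ (M.R i) = M'.R i

/-- The number of automorphisms (self-equivalences) of a hypermap. -/
noncomputable def hAutCard {m n : ℕ} (M : HMapData m n) : ℕ :=
  Nat.card {φ : Perm (Fin m) //
    φ * M.s0 * φ⁻¹ = M.s0 ∧ φ * M.s1 * φ⁻¹ = M.s1 ∧ φ * M.s2 * φ⁻¹ = M.s2 ∧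
    ∀ i, φ (M.R i) = M.R i}

/-- The defining conditions for the hypermap enumeration: boundary degrees given by the
partition `degs` (in a fixed, sorted, order), `-χ(M) = a`, `nf i` internal faces of
degree `i` and `ef i` hyperedges of degree `i` for every `i`, and (if `fs = true`)
full simplicity. -/
def HCond {m n : ℕ} (degs : Multiset ℕ) (a : ℤ) (nf ef : ℕ →₀ ℕ) (fs : Bool)
    (M : HMapData m n) : Prop :=
  M.boundaryDegrees = degs.sort (· ≤ ·) ∧
  -M.eulerChar = a ∧
  (∀ i, M.internalCount i = nf i) ∧
  (∀ i, M.hyperedgeCount i = ef i) ∧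
  (fs = true → M.FullySimple)

/-- The weighted enumeration of (fully simple, if `fs = true`) hypermaps: the sum of
`1/|Aut M|` over equivalence classes of hypermaps with boundary face degrees `p`,
Euler characteristic `-a`, `nf i` internal faces and `ef i` hyperedges of degree `i`.
Any such hypermap has `d + Σᵢ i · nf i` edges. -/
noncomputable def hMapEnum (d : ℕ) (p : Nat.Partition d) (a : ℤ) (nf ef : ℕ →₀ ℕ)
    (fs : Bool) : ℚ :=
  ∑ᶠ c : Quot (fun M M' : {M : HMapData (d + nf.sum fun i k => i * k)
      (Multiset.card p.parts) // HCond p.parts a nf ef fs M} => HMapEquivRel M.1 M'.1),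
    (1 : ℚ) / (hAutCard c.out.1 : ℚ)

end FSM
namespace FSM

section CycleCounting

lemma quot_out_sameCycle {α : Type*} (s : Perm α) (x : α) :
    s.SameCycle (Quot.mk s.SameCycle x).out x :=
  (Perm.SameCycle.equivalence s).quot_mk_eq_iff _ _ |>.1 (Quot.out_eq _)

lemma quot_mk_sameCycle_iff {α : Type*} (s : Perm α) (x y : α) :
    Quot.mk s.SameCycle x = Quot.mk s.SameCycle y ↔ s.SameCycle x y :=
  (Perm.SameCycle.equivalence s).quot_mk_eq_iff _ _

/-- Cycles on which `P` holds can be counted through any bijection respecting the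
cycles on which `P` holds. -/
lemma card_quot_sameCycle_congr {α β : Type*} (φ : α ≃ β) {s : Perm α} {t : Perm β}
    {P : α → Prop} {Q : β → Prop}
    (hP : ∀ x y, s.SameCycle x y → P x → P y)
    (hQ : ∀ x, Q (φ x) ↔ P x)
    (h : ∀ x y, P x → (t.SameCycle (φ x) (φ y) ↔ s.SameCycle x y)) :
    Nat.card {q : Quot s.SameCycle // P q.out} = Nat.card {q : Quot t.SameCycle // Q q.out} := by
  have key : ∀ x, P x → P (φ.symm (Quot.mk t.SameCycle (φ x)).out) ∧
      s.SameCycle x (φ.symm (Quot.mk t.SameCycle (φ x)).out) := by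
    intro x hx
    have h1 := (quot_out_sameCycle t (φ x)).symm
    have h2 := (h x (φ.symm (Quot.mk t.SameCycle (φ x)).out) hx).1 (by simpa using h1)
    exact ⟨hP _ _ h2 hx, h2⟩
  refine Nat.card_eq_of_bijective
    (fun q => ⟨Quot.mk _ (φ q.1.out), by
      have := (key _ q.2).1
      rwa [← hQ, φ.apply_symm_apply] at this⟩) ⟨?_, ?_⟩
  · rintro ⟨q, hq⟩ ⟨q', hq'⟩ hqq
    simp only [Subtype.mk.injEq] at hqq ⊢
    have := ((Perm.SameCycle.equivalence t).quot_mk_eq_iff _ _).1 hqq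
    rw [h _ _ hq] at this
    rw [← Quot.out_eq q, ← Quot.out_eq q']
    exact Quot.sound this
  · rintro ⟨q, hq⟩
    have hpx : P (φ.symm q.out) := by rw [← hQ]; simpa using hq
    have hpy := hP _ _ (quot_out_sameCycle s (φ.symm q.out)).symm hpx
    refine ⟨⟨Quot.mk _ (φ.symm q.out), hpy⟩, ?_⟩
    simp only [Subtype.mk.injEq]
    conv_rhs => rw [← Quot.out_eq q]
    refine Quot.sound ?_
    have := (h _ (φ.symm q.out) hpy).2 (quot_out_sameCycle s _)
    simpa using this

lemma zpow_equivariant {α β : Type*} {f : α → β} {ρ : Perm α} {s : Perm β}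
    (h : ∀ i, s (f i) = f (ρ i)) (k : ℤ) (x : α) : (s ^ k) (f x) = f ((ρ ^ k) x) := by
  have hp : ∀ (k : ℕ) x, (s ^ k) (f x) = f ((ρ ^ k) x) := by
    intro k
    induction k with
    | zero => simp
    | succ k ih => intro x; simp only [pow_succ, Perm.mul_apply, h, ih]
  obtain ⟨k, rfl | rfl⟩ := k.eq_nat_or_neg
  · simpa using hp k x
  · rw [zpow_neg, zpow_neg, Perm.inv_eq_iff_eq, zpow_natCast, zpow_natCast, hp,
      ← Perm.mul_apply, mul_inv_cancel, Perm.one_apply]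

lemma sameCycle_equivariant {α β : Type*} {f : α → β} (hf : Function.Injective f)
    {ρ : Perm α} {s : Perm β} (h : ∀ i, s (f i) = f (ρ i)) (x y : α) :
    s.SameCycle (f x) (f y) ↔ ρ.SameCycle x y := by
  simp only [Perm.SameCycle, zpow_equivariant h, hf.eq_iff]

lemma mem_range_of_sameCycle {α β : Type*} {f : α → β} {ρ : Perm α} {s : Perm β}
    (h : ∀ i, s (f i) = f (ρ i)) {x y : β} (hxy : s.SameCycle x y) (hx : x ∈ Set.range f) :
    y ∈ Set.range f := by
  obtain ⟨k, rfl⟩ := hxy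
  obtain ⟨x, rfl⟩ := hx
  exact ⟨_, (zpow_equivariant h k x).symm⟩

/-- If the points of the range of `f` lie in distinct cycles of `s`, then the cycles of
`π ∘ s`, where `π` permutes that range, are those of `s` missing the range, together with
one cycle for each cycle of `π`. -/
lemma sameCycle_viaEmbedding_mul {α β : Type*} [Finite α] [Finite β] (f : α ↪ β)
    (π : Perm α) (s : Perm β)
    (hs : ∀ i j, s.SameCycle (f i) (f j) → i = j) :
    (∀ x y, s.SameCycle x y → (π.viaEmbedding f * s).SameCycle x y) ∧
    (∀ i j, π.SameCycle i j → (π.viaEmbedding f * s).SameCycle (f i) (f j)) ∧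
    (∀ i x, (π.viaEmbedding f * s).SameCycle (f i) x →
      ∃ j, π.SameCycle i j ∧ s.SameCycle (f j) x) ∧
    (∀ x, (∀ i, ¬ s.SameCycle x (f i)) →
      ∀ y, (π.viaEmbedding f * s).SameCycle x y → s.SameCycle x y) := by
  set t := π.viaEmbedding f * s with ht
  have step : ∀ x i, s x = f i → t.SameCycle (f i) x := by
    intro x i hxi
    have : ∀ k : ℕ, t.SameCycle (f i) ((s ^ k) (f i)) := by
      intro k
      induction k with
      | zero => exact Perm.SameCycle.refl _ _
      | succ k ih =>
        by_cases hm : (s ^ (k + 1)) (f i) ∈ Set.range f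
        · obtain ⟨j, hj⟩ := hm
          have : i = j := hs _ _ ⟨(k + 1 : ℕ), by rw [zpow_natCast, hj]⟩
          rw [← hj, this]
        · have : (s ^ (k + 1)) (f i) = t ((s ^ k) (f i)) := by
            rw [pow_succ', Perm.mul_apply] at hm ⊢
            rw [ht, Perm.mul_apply, Perm.viaEmbedding_apply_of_notMem _ _ _ hm]
          rw [this, Perm.sameCycle_apply_right]
          exact ih
    obtain ⟨k, hk⟩ := (show s.SameCycle (f i) x by
      rw [← hxi, Perm.sameCycle_apply_left]).exists_nat_pow_eq
    rw [← hk]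
    exact this k
  have one : ∀ x, t.SameCycle x (s x) := by
    intro x
    by_cases hm : s x ∈ Set.range f
    · obtain ⟨i, hi⟩ := hm
      rw [← hi]
      exact (step x i hi.symm).symm
    · have : s x = t x := by
        rw [ht, Perm.mul_apply, Perm.viaEmbedding_apply_of_notMem _ _ _ hm]
      rw [this, Perm.sameCycle_apply_right]
  have onepi : ∀ i, t.SameCycle (f i) (f (π i)) := by
    intro i
    have h1 := one (s.symm (f i))
    rw [Equiv.apply_symm_apply] at h1
    have h2 : t (s.symm (f i)) = f (π i) := by
      rw [ht, Perm.mul_apply, Equiv.apply_symm_apply, Perm.viaEmbedding_apply]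
    rw [← h2, Perm.sameCycle_apply_right]
    exact h1.symm
  refine ⟨?_, ?_, ?_, ?_⟩
  · intro x y hxy
    obtain ⟨k, rfl⟩ := hxy.exists_nat_pow_eq
    clear hxy
    induction k with
    | zero => exact Perm.SameCycle.refl _ _
    | succ k ih => rw [pow_succ', Perm.mul_apply]; exact ih.trans (one _)
  · intro x y hxy
    obtain ⟨k, rfl⟩ := hxy.exists_nat_pow_eq
    clear hxy
    induction k with
    | zero => exact Perm.SameCycle.refl _ _
    | succ k ih => rw [pow_succ', Perm.mul_apply]; exact ih.trans (onepi _)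
  · intro i x hx
    obtain ⟨k, rfl⟩ := hx.exists_nat_pow_eq
    clear hx
    induction k with
    | zero => exact ⟨i, Perm.SameCycle.refl _ _, Perm.SameCycle.refl _ _⟩
    | succ k ih =>
      obtain ⟨j, hj, hjx⟩ := ih
      rw [pow_succ', Perm.mul_apply]
      by_cases hm : s ((t ^ k) (f i)) ∈ Set.range f
      · obtain ⟨l, hl⟩ := hm
        have : t ((t ^ k) (f i)) = f (π l) := by
          conv_lhs => rw [ht]
          rw [Perm.mul_apply, ← ht, ← hl, Perm.viaEmbedding_apply]
        have hjl : j = l := hs _ _ (by rw [hl, Perm.sameCycle_apply_right]; exact hjx)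
        exact ⟨π l, by rw [Perm.sameCycle_apply_right, ← hjl]; exact hj, by rw [this]⟩
      · have : t ((t ^ k) (f i)) = s ((t ^ k) (f i)) := by
          conv_lhs => rw [ht]
          rw [Perm.mul_apply, ← ht, Perm.viaEmbedding_apply_of_notMem _ _ _ hm]
        exact ⟨j, hj, by rw [this, Perm.sameCycle_apply_right]; exact hjx⟩
  · intro x hx y hxy
    obtain ⟨k, rfl⟩ := hxy.exists_nat_pow_eq
    clear hxy
    induction k with
    | zero => exact Perm.SameCycle.refl _ _
    | succ k ih =>
      rw [pow_succ', Perm.mul_apply]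
      have hm : s ((t ^ k) x) ∉ Set.range f := by
        rintro ⟨l, hl⟩
        exact hx l (by rw [hl, Perm.sameCycle_apply_right]; exact ih)
      have : t ((t ^ k) x) = s ((t ^ k) x) := by
        conv_lhs => rw [ht]
        rw [Perm.mul_apply, ← ht, Perm.viaEmbedding_apply_of_notMem _ _ _ hm]
      rw [this, Perm.sameCycle_apply_right]
      exact ih

lemma cycleCount_viaEmbedding_mul_aux {α β : Type*} [Finite α] [Finite β] (f : α ↪ β)
    (π : Perm α) (s : Perm β) (hs : ∀ i j, s.SameCycle (f i) (f j) → i = j) :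
    cycleCount (π.viaEmbedding f * s) = cycleCount π +
      Nat.card {q : Quot s.SameCycle // ∀ i, ¬ s.SameCycle q.out (f i)} := by
  obtain ⟨h1, h2, h3, h4⟩ := sameCycle_viaEmbedding_mul f π s hs
  have : Finite (Quot s.SameCycle) := Finite.of_surjective _ Quot.mk_surjective
  have : Finite (Quot π.SameCycle) := Finite.of_surjective _ Quot.mk_surjective
  rw [cycleCount, cycleCount, ← Nat.card_sum]
  symm
  refine Nat.card_eq_of_bijective
    (Sum.elim (fun q => Quot.mk _ (f q.out)) (fun q => Quot.mk _ q.1.out)) ⟨?_, ?_⟩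
  · have hne : ∀ (q : Quot π.SameCycle)
        (q' : {q : Quot s.SameCycle // ∀ i, ¬ s.SameCycle q.out (f i)}),
        ¬ (π.viaEmbedding f * s).SameCycle (f q.out) q'.1.out := by
      intro q q' h
      obtain ⟨j, -, hj⟩ := h3 _ _ h
      exact q'.2 j hj.symm
    rintro (q | q) (q' | q') h
    · simp only [Sum.elim_inl, quot_mk_sameCycle_iff] at h
      obtain ⟨j, hj, hj'⟩ := h3 _ _ h
      rw [hs _ _ hj', ← quot_mk_sameCycle_iff, Quot.out_eq, Quot.out_eq] at hj
      rw [hj]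
    · simp only [Sum.elim_inl, Sum.elim_inr, quot_mk_sameCycle_iff] at h
      exact (hne _ _ h).elim
    · simp only [Sum.elim_inl, Sum.elim_inr, quot_mk_sameCycle_iff] at h
      exact (hne _ _ h.symm).elim
    · simp only [Sum.elim_inr, quot_mk_sameCycle_iff] at h
      have := h4 _ q.2 _ h
      rw [← quot_mk_sameCycle_iff, Quot.out_eq, Quot.out_eq] at this
      rw [Subtype.ext this]
  · intro q
    induction q using Quot.ind with
    | mk x =>
    by_cases hx : ∀ i, ¬ s.SameCycle x (f i)
    · refine ⟨Sum.inr ⟨Quot.mk _ x, fun i hi => hx i ?_⟩, ?_⟩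
      · exact (quot_out_sameCycle s x).symm.trans hi
      · simp only [Sum.elim_inr, quot_mk_sameCycle_iff]
        exact h1 _ _ (quot_out_sameCycle s x)
    · push Not at hx
      obtain ⟨i, hi⟩ := hx
      refine ⟨Sum.inl (Quot.mk _ i), ?_⟩
      simp only [Sum.elim_inl, quot_mk_sameCycle_iff]
      exact (h2 _ _ (quot_out_sameCycle π i)).trans (h1 _ _ hi.symm)

lemma cycleCount_one {α : Type*} : cycleCount (1 : Perm α) = Nat.card α := by
  refine (Nat.card_eq_of_bijective (Quot.mk _) ⟨fun x y h => ?_, Quot.mk_surjective⟩).symm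
  rwa [quot_mk_sameCycle_iff, Perm.sameCycle_one] at h

lemma cycleCount_viaEmbedding_mul {α β : Type*} [Finite α] [Finite β] (f : α ↪ β)
    (π : Perm α) (s : Perm β) (hs : ∀ i j, s.SameCycle (f i) (f j) → i = j) :
    cycleCount (π.viaEmbedding f * s) + Nat.card α = cycleCount s + cycleCount π := by
  have h1 := cycleCount_viaEmbedding_mul_aux f π s hs
  have h2 := cycleCount_viaEmbedding_mul_aux f 1 s hs
  rw [← Perm.viaEmbeddingHom_apply, map_one, one_mul, cycleCount_one] at h2
  omega

lemma cycleCount_le {α : Type*} [Finite α] (s : Perm α) : cycleCount s ≤ Nat.card α :=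
  Nat.card_le_card_of_surjective _ Quot.mk_surjective

lemma cycleCount_conj {α : Type*} (φ s : Perm α) : cycleCount (φ * s * φ⁻¹) = cycleCount s := by
  have := card_quot_sameCycle_congr φ (s := s) (t := φ * s * φ⁻¹) (P := fun _ => True)
    (Q := fun _ => True) (by simp) (by simp) (by simp [Perm.sameCycle_conj])
  rw [Nat.card_congr (Equiv.subtypeUnivEquiv (fun _ => trivial)),
    Nat.card_congr (Equiv.subtypeUnivEquiv (fun _ => trivial))] at this
  exact this.symm

end CycleCounting

end FSM

namespace FSM

section Monotone

variable {d : ℕ}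

/-- The transpositions of the strictly monotone list encoded by a list of pairs, with all
larger entries below `m`. -/
def IsMonotoneBelow (m : ℕ) (ab : List (Fin d × Fin d)) : Prop :=
  (∀ p ∈ ab, p.1 < p.2 ∧ p.2.val < m) ∧ (ab.map Prod.snd).Pairwise (· < ·)

/-- The product of the transpositions encoded by a list of pairs. -/
def swapProd (ab : List (Fin d × Fin d)) : Perm (Fin d) :=
  (ab.map fun p => Equiv.swap p.1 p.2).prod

lemma swapProd_append_singleton (ab : List (Fin d × Fin d)) (p : Fin d × Fin d) :
    swapProd (ab ++ [p]) = swapProd ab * Equiv.swap p.1 p.2 := by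
  simp [swapProd]

lemma IsMonotoneBelow.swapProd_apply {m : ℕ} {ab : List (Fin d × Fin d)}
    (h : IsMonotoneBelow m ab) {i : Fin d} (hi : m ≤ i.val) : swapProd ab i = i := by
  have h1 := h.1
  clear h
  induction ab with
  | nil => simp [swapProd]
  | cons p ab ih =>
    have hp := h1 p (by simp)
    have hlt := Fin.lt_def.1 hp.1
    have : swapProd (p :: ab) = Equiv.swap p.1 p.2 * swapProd ab := by simp [swapProd]
    rw [this, Perm.mul_apply, ih fun q hq => h1 q (by simp [hq])]
    exact Equiv.swap_apply_of_ne_of_ne (by intro h; rw [h] at hi; omega)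
      (by intro h; rw [h] at hi; omega)

lemma IsMonotoneBelow.succ_cases {m : ℕ} (hm : m < d) {ab : List (Fin d × Fin d)}
    (h : IsMonotoneBelow (m + 1) ab) :
    IsMonotoneBelow m ab ∨ ∃ ab' a, ab = ab' ++ [(a, ⟨m, hm⟩)] ∧ IsMonotoneBelow m ab' ∧
      a < ⟨m, hm⟩ := by
  rcases List.eq_nil_or_concat ab with rfl | ⟨ab', p, rfl⟩
  · exact Or.inl ⟨by simp, by simp⟩
  · rw [List.concat_eq_append] at h ⊢
    obtain ⟨h1, h2⟩ := h
    simp only [List.map_append, List.map_cons, List.map_nil,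
      List.pairwise_append, List.mem_singleton] at h2
    have hp := h1 p (by simp)
    have hb : ∀ q ∈ ab', q.2 < p.2 := fun q hq =>
      h2.2.2 _ (List.mem_map_of_mem hq) _ rfl
    have hab : IsMonotoneBelow p.2.val ab' :=
      ⟨fun q hq => ⟨(h1 q (by simp [hq])).1, Fin.lt_def.1 (hb q hq)⟩, h2.1⟩
    by_cases hpm : p.2.val = m
    · subst hpm
      exact Or.inr ⟨ab', p.1, by simp, hab, hp.1⟩
    · refine Or.inl ⟨fun q hq => ?_, ?_⟩
      · refine ⟨(h1 q hq).1, ?_⟩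
        simp only [List.mem_append, List.mem_singleton] at hq
        rcases hq with hq | rfl
        · have := Fin.lt_def.1 (hb q hq)
          omega
        · omega
      · simpa [List.pairwise_append] using h2

lemma IsMonotoneBelow.eq_of_swapProd_eq {m : ℕ} (hm : m ≤ d) {ab ab' : List (Fin d × Fin d)}
    (h : IsMonotoneBelow m ab) (h' : IsMonotoneBelow m ab') (he : swapProd ab = swapProd ab') :
    ab = ab' := by
  induction m generalizing ab ab' with
  | zero =>
    have : ∀ ab : List (Fin d × Fin d), IsMonotoneBelow 0 ab → ab = [] := fun ab h =>
      List.eq_nil_iff_forall_not_mem.2 fun p hp => absurd (h.1 p hp).2 (by omega)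
    rw [this ab h, this ab' h']
  | succ m ih =>
    set x : Fin d := ⟨m, hm⟩
    have last : ∀ (ab : List (Fin d × Fin d)) a, IsMonotoneBelow m ab →
        swapProd (ab ++ [(a, x)]) a = x := by
      intro ab a h
      rw [swapProd_append_singleton, Perm.mul_apply, Equiv.swap_apply_left]
      exact h.swapProd_apply le_rfl
    rcases h.succ_cases hm with k | ⟨ab, a, rfl, k, ha⟩ <;>
    rcases h'.succ_cases hm with k' | ⟨ab', a', rfl, k', ha'⟩
    · exact ih (by omega) k k' he
    · have h1 := last ab' a' k'
      rw [← he] at h1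
      have h2 : swapProd ab x = x := k.swapProd_apply le_rfl
      exact absurd ((swapProd ab).injective (h1.trans h2.symm)) ha'.ne
    · have h1 := last ab a k
      rw [he] at h1
      have h2 : swapProd ab' x = x := k'.swapProd_apply le_rfl
      exact absurd ((swapProd ab').injective (h1.trans h2.symm)) ha.ne
    · have h1 := last ab a k
      have h2 := last ab' a' k'
      rw [← he] at h2
      obtain rfl := (swapProd _).injective (h1.trans h2.symm)
      rw [swapProd_append_singleton, swapProd_append_singleton] at he
      rw [ih (by omega) k k' (mul_right_cancel he)]

/-- Multiplying by a transposition moving a fixed point decreases the number of cycles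
by one. -/
lemma cycleCount_mul_swap (π : Perm (Fin d)) {a x : Fin d} (hax : a ≠ x) (hx : π x = x) :
    cycleCount (π * Equiv.swap a x) + 1 = cycleCount π := by
  obtain ⟨f, hf0, hf1⟩ : ∃ f : Fin 2 ↪ Fin d, f 0 = a ∧ f 1 = x := ⟨⟨ ![a, x], by
    intro i j; fin_cases i <;> fin_cases j <;> simp [hax, hax.symm]⟩, rfl, rfl⟩
  have hs : ∀ i j, π.SameCycle (f i) (f j) → i = j := by
    have : ¬ π.SameCycle a x := fun h => hax (h.eq_of_right hx)
    have : ¬ π.SameCycle x a := fun h => hax (h.eq_of_left hx).symm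
    intro i j
    fin_cases i <;> fin_cases j <;> simp [*]
  have key := cycleCount_viaEmbedding_mul f (Equiv.swap 0 1) π hs
  have hswap : (Equiv.swap (0 : Fin 2) 1).viaEmbedding f = Equiv.swap a x := by
    ext y : 1
    by_cases hy : y ∈ Set.range f
    · obtain ⟨i, rfl⟩ := hy
      rw [Perm.viaEmbedding_apply]
      fin_cases i <;> simp [hf0, hf1]
    · rw [Perm.viaEmbedding_apply_of_notMem _ _ _ hy, Equiv.swap_apply_of_ne_of_ne]
      · rintro rfl; exact hy ⟨0, hf0⟩
      · rintro rfl; exact hy ⟨1, hf1⟩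
  have hone : cycleCount (Equiv.swap (0 : Fin 2) 1) = 1 := by
    rw [cycleCount, Nat.card_eq_one_iff_unique]
    refine ⟨⟨?_⟩, ⟨Quot.mk _ 0⟩⟩
    have hc : ∀ i, (Equiv.swap (0 : Fin 2) 1).SameCycle 0 i := by
      intro i
      fin_cases i
      · exact Perm.SameCycle.refl _ _
      · exact ⟨1, by simp⟩
    intro p q
    induction p using Quot.ind
    induction q using Quot.ind
    exact Quot.sound ((hc _).symm.trans (hc _))
  have hconj : π * Equiv.swap a x =
      (Equiv.swap a x)⁻¹ * (Equiv.swap a x * π) * (Equiv.swap a x)⁻¹⁻¹ := by group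
  rw [hswap, hone, Nat.card_eq_fintype_card, Fintype.card_fin] at key
  rw [hconj, cycleCount_conj]
  omega

lemma exists_isMonotoneBelow {m : ℕ} (hm : m ≤ d) (π : Perm (Fin d))
    (hπ : ∀ i : Fin d, m ≤ i.val → π i = i) :
    ∃ ab, IsMonotoneBelow m ab ∧ swapProd ab = π ∧ ab.length + cycleCount π = d := by
  induction m generalizing π with
  | zero =>
    obtain rfl : π = 1 := by ext i : 1; exact hπ i (Nat.zero_le _)
    exact ⟨[], ⟨by simp, by simp⟩, by simp [swapProd], by simp [cycleCount_one]⟩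
  | succ m ih =>
    set x : Fin d := ⟨m, hm⟩ with hxdef
    by_cases hx : π x = x
    · obtain ⟨ab, h1, h2, h3⟩ := ih (by omega) π (fun i hi => by
        rcases hi.eq_or_lt with h | h
        · obtain rfl : x = i := Fin.ext h
          exact hx
        · exact hπ i h)
      exact ⟨ab, ⟨fun p hp => ⟨(h1.1 p hp).1, by have := (h1.1 p hp).2; omega⟩, h1.2⟩, h2, h3⟩
    · set a := π.symm x with hadef
      have hπa : π a = x := by simp [hadef]
      have hax : a ≠ x := fun h => hx (by rw [h] at hπa; exact hπa)
      have halt : a < x := by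
        by_contra hlt
        have : m ≤ a.val := Fin.le_def.1 (not_lt.1 hlt)
        have hne : m ≠ a.val := fun h => hax (Fin.ext h.symm)
        have := hπ a (by omega)
        exact hax (this.symm.trans hπa)
      have hfix : (π * Equiv.swap a x) x = x := by
        rw [Perm.mul_apply, Equiv.swap_apply_right, hπa]
      obtain ⟨ab, h1, h2, h3⟩ := ih (by omega) (π * Equiv.swap a x) (fun i hi => by
        rcases hi.eq_or_lt with h | h
        · obtain rfl : x = i := Fin.ext h
          exact hfix
        · have hxi : i ≠ x := by rintro rfl; exact absurd h (by simp [hxdef])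
          have hai : i ≠ a := by
            rintro h'
            rw [Fin.lt_def, ← h'] at halt
            simp only [hxdef] at halt
            omega
          rw [Perm.mul_apply, Equiv.swap_apply_of_ne_of_ne hai hxi]
          exact hπ i h)
      refine ⟨ab ++ [(a, x)], ⟨?_, ?_⟩, ?_, ?_⟩
      · intro p hp
        simp only [List.mem_append, List.mem_singleton] at hp
        rcases hp with hp | rfl
        · have := h1.1 p hp
          exact ⟨this.1, by omega⟩
        · exact ⟨halt, by simp [hxdef]⟩
      · simp only [List.map_append, List.map_cons, List.map_nil,
          List.pairwise_append, List.mem_singleton]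
        refine ⟨h1.2, by simp, ?_⟩
        rintro b hb _ rfl
        obtain ⟨p, hp, rfl⟩ := List.mem_map.1 hb
        exact Fin.lt_def.2 (h1.1 p hp).2
      · rw [swapProd_append_singleton, h2]
        simp [mul_assoc]
      · have := cycleCount_mul_swap (π * Equiv.swap a x) hax hfix
        rw [mul_assoc, Equiv.swap_mul_self, mul_one] at this
        simp only [List.length_append, List.length_singleton]
        omega

lemma isStrictlyMonotone_iff {l : List (Perm (Fin d))} :
    IsStrictlyMonotone l ↔ ∃ ab : List (Fin d × Fin d),
      l = ab.map (fun p => Equiv.swap p.1 p.2) ∧ IsMonotoneBelow d ab := by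
  refine exists_congr fun ab => and_congr_right fun _ => ?_
  rw [IsMonotoneBelow]
  refine and_congr ?_ ?_
  · exact forall₂_congr fun p _ => (and_iff_left p.2.isLt).symm
  · exact List.isChain_iff_pairwise

/-- Every permutation is the product of exactly one strictly monotone list. -/
lemma existsUnique_isStrictlyMonotone (π : Perm (Fin d)) :
    ∃! l : List (Perm (Fin d)), IsStrictlyMonotone l ∧ l.prod = π := by
  obtain ⟨ab, h1, h2, -⟩ := exists_isMonotoneBelow le_rfl π (fun i hi => absurd i.2 (by omega))
  refine ⟨ab.map (fun p : Fin d × Fin d => Equiv.swap p.1 p.2),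
    ⟨isStrictlyMonotone_iff.2 ⟨ab, rfl, h1⟩, h2⟩, ?_⟩
  rintro l ⟨hl, hp⟩
  obtain ⟨ab', rfl, h'⟩ := isStrictlyMonotone_iff.1 hl
  rw [h'.eq_of_swapProd_eq le_rfl h1 (hp.trans h2.symm)]

lemma IsStrictlyMonotone.length_add_cycleCount {l : List (Perm (Fin d))}
    (hl : IsStrictlyMonotone l) : l.length + cycleCount l.prod = d := by
  obtain ⟨ab, h1, h2, h3⟩ :=
    exists_isMonotoneBelow le_rfl l.prod (fun i hi => absurd i.2 (by omega))
  obtain ⟨ab', rfl, h'⟩ := isStrictlyMonotone_iff.1 hl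
  rw [h'.eq_of_swapProd_eq le_rfl h1 h2.symm] at h3 ⊢
  simpa using h3

end Monotone

end FSM

namespace FSM

section CycleType

lemma orbitSize_eq_of_sameCycle_iff {α β : Type*} (φ : α ≃ β) {s : Perm α} {t : Perm β} {x : α}
    (h : ∀ y, t.SameCycle (φ x) (φ y) ↔ s.SameCycle x y) : orbitSize t (φ x) = orbitSize s x :=
  (Nat.card_congr (φ.subtypeEquiv fun y => (h y).symm)).symm

lemma orbitSize_eq_of_sameCycle {α : Type*} {s : Perm α} {x y : α} (h : s.SameCycle x y) :
    orbitSize s x = orbitSize s y :=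
  Nat.card_congr ((Equiv.refl α).subtypeEquiv fun _ => ⟨h.symm.trans, h.trans⟩)

lemma orbitSize_eq_one_iff {α : Type*} (s : Perm α) (x : α) : orbitSize s x = 1 ↔ s x = x := by
  rw [orbitSize, Nat.card_eq_one_iff_unique]
  constructor
  · rintro ⟨h, -⟩
    exact congrArg Subtype.val (Subsingleton.elim
      (⟨s x, by rw [Perm.sameCycle_apply_right]⟩ : {y // s.SameCycle x y})
      ⟨x, Perm.SameCycle.refl _ _⟩)
  · intro h
    exact ⟨⟨fun y z => Subtype.ext ((y.2.eq_of_left h).symm.trans (z.2.eq_of_left h))⟩,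
      ⟨⟨x, Perm.SameCycle.refl _ _⟩⟩⟩

variable {α : Type*} [Fintype α] [DecidableEq α]

lemma orbitSize_eq_card_support_cycleOf (s : Perm α) {x : α} (hx : s x ≠ x) :
    orbitSize s x = (s.cycleOf x).support.card := by
  rw [orbitSize, Nat.card_eq_fintype_card, Fintype.card_subtype]
  congr 1
  ext y
  rw [Perm.mem_support_cycleOf_iff, Perm.mem_support, Finset.mem_filter_univ, and_iff_left hx]

/-- The full cycle type is the multiset of orbit sizes. -/
lemma fullCycleType_eq_map_orbitSize (s : Perm α) [Fintype (Quot s.SameCycle)] :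
    fullCycleType s =
      (Finset.univ : Finset (Quot s.SameCycle)).val.map fun q => orbitSize s q.out := by
  classical
  have hfix : ∀ q : Quot s.SameCycle, orbitSize s q.out = 1 ↔ s q.out = q.out := fun q =>
    orbitSize_eq_one_iff s _
  rw [← Multiset.filter_add_not (fun q : Quot s.SameCycle => s q.out ≠ q.out)
    (Finset.univ : Finset (Quot s.SameCycle)).val, Multiset.map_add, fullCycleType]
  congr 1
  · rw [Perm.cycleType_def]
    refine (Multiset.map_eq_map_of_bij_of_nodup _ _ ((Finset.univ).nodup.filter _)
      s.cycleFactorsFinset.nodup (fun q _ => s.cycleOf q.out) ?_ ?_ ?_ ?_).symm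
    · intro q hq
      rw [Finset.mem_val, Perm.cycleOf_mem_cycleFactorsFinset_iff, Perm.mem_support]
      exact (Multiset.mem_filter.1 hq).2
    · intro q hq q' hq' h
      have hq := (Multiset.mem_filter.1 hq).2
      have : q.out ∈ (s.cycleOf q'.out).support := by
        rw [← h, Perm.mem_support_cycleOf_iff]
        exact ⟨Perm.SameCycle.refl _ _, Perm.mem_support.2 hq⟩
      have := (Perm.mem_support_cycleOf_iff.1 this).1
      rw [← quot_mk_sameCycle_iff, Quot.out_eq, Quot.out_eq] at this
      exact this.symm
    · intro c hc
      rw [Finset.mem_val] at hc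
      obtain ⟨hc1, hc2⟩ := Perm.mem_cycleFactorsFinset_iff.1 hc
      obtain ⟨x, hx⟩ := hc1.nonempty_support
      have hcx : s.cycleOf x = c := (Perm.cycle_is_cycleOf hx hc).symm
      have hsx : s x ≠ x := by
        rw [← hc2 x hx]; exact Perm.mem_support.1 hx
      have hs := quot_out_sameCycle s x
      refine ⟨Quot.mk _ x, Multiset.mem_filter.2 ⟨Finset.mem_univ_val _, ?_⟩, ?_⟩
      · rwa [Ne, hs.apply_eq_self_iff]
      · rw [hs.cycleOf_eq, hcx]
    · intro q hq
      exact orbitSize_eq_card_support_cycleOf s (Multiset.mem_filter.1 hq).2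
  · symm
    rw [Multiset.eq_replicate]
    constructor
    · rw [Multiset.card_map, ← Finset.filter_val, Finset.card_val, ← Finset.card_compl]
      refine Finset.card_bij (fun q _ => q.out) ?_ ?_ ?_
      · intro q hq
        simpa using hq
      · intro q _ q' _ h
        rw [← Quot.out_eq q, h, Quot.out_eq]
      · intro x hx
        have hsx : s x = x := by simpa using hx
        have hs := quot_out_sameCycle s x
        have : (Quot.mk s.SameCycle x).out = x := hs.eq_of_right hsx
        exact ⟨Quot.mk _ x, by simp [this, hsx], this⟩
    · intro b hb
      obtain ⟨q, hq, rfl⟩ := Multiset.mem_map.1 hb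
      have := (Multiset.mem_filter.1 hq).2
      rw [not_not] at this
      exact (hfix q).2 this

lemma fullCycleType_sum (s : Perm α) : (fullCycleType s).sum = Fintype.card α := by
  have := Finset.card_le_univ s.support
  simp only [fullCycleType, Multiset.sum_add, Perm.sum_cycleType, Multiset.sum_replicate,
    smul_eq_mul, mul_one]
  omega

lemma fullCycleType_pos (s : Perm α) {i : ℕ} (hi : i ∈ fullCycleType s) : 0 < i := by
  rw [fullCycleType, Multiset.mem_add] at hi
  rcases hi with hi | hi
  · exact lt_trans one_pos (Perm.one_lt_of_mem_cycleType hi)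
  · rw [Multiset.eq_of_mem_replicate hi]; exact one_pos

lemma fullCycleType_conj (φ s : Perm α) : fullCycleType (φ * s * φ⁻¹) = fullCycleType s := by
  rw [fullCycleType, fullCycleType, Perm.cycleType_conj, Perm.card_support_conj]

lemma fullCycleType_inv (s : Perm α) : fullCycleType s⁻¹ = fullCycleType s := by
  rw [fullCycleType, fullCycleType, Perm.cycleType_inv, Perm.support_inv]

lemma filter_fullCycleType (s : Perm α) : (fullCycleType s).filter (2 ≤ ·) = s.cycleType := by
  rw [fullCycleType, Multiset.filter_add,
    Multiset.filter_eq_self.2 fun a ha => Perm.two_le_of_mem_cycleType ha,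
    Multiset.filter_eq_nil.2 fun a ha => by rw [Multiset.eq_of_mem_replicate ha]; omega,
    add_zero]

lemma fullCycleType_eq_iff_isConj {s t : Perm α} :
    fullCycleType s = fullCycleType t ↔ IsConj s t := by
  rw [Perm.isConj_iff_cycleType_eq]
  constructor
  · intro h
    rw [← filter_fullCycleType, ← filter_fullCycleType, h]
  · intro h
    rw [fullCycleType, fullCycleType, h, ← Perm.sum_cycleType, ← Perm.sum_cycleType, h]

variable {d : ℕ}

lemma card_fullCycleType_mul_zPart (lam : Nat.Partition d) :
    Nat.card {s : Perm (Fin d) // fullCycleType s = lam.parts} * zPart lam = d.factorial := by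
  set m := lam.parts.filter (2 ≤ ·) with hm
  have hsplit : lam.parts = m + Multiset.replicate (lam.parts.count 1) 1 := by
    conv_lhs => rw [← Multiset.filter_add_not (2 ≤ ·) lam.parts]
    rw [← Multiset.filter_eq' lam.parts 1]
    congr 1
    refine Multiset.filter_congr fun x hx => ?_
    have := lam.parts_pos hx
    omega
  have hsum : m.sum + lam.parts.count 1 = d := by
    have := congrArg Multiset.sum hsplit
    rw [lam.parts_sum, Multiset.sum_add, Multiset.sum_replicate, smul_eq_mul, mul_one] at this
    exact this.symm
  have hprod : lam.parts.prod = m.prod := by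
    have := congrArg Multiset.prod hsplit
    rwa [Multiset.prod_add, Multiset.prod_replicate, one_pow, mul_one] at this
  have hiff : ∀ s : Perm (Fin d), fullCycleType s = lam.parts ↔ s.cycleType = m := by
    intro s
    constructor
    · intro h
      rw [hm, ← h, filter_fullCycleType]
    · intro h
      conv_rhs => rw [hsplit]
      rw [fullCycleType, ← Perm.sum_cycleType, h, Fintype.card_fin]
      congr 2
      omega
  have hcount : ∏ j ∈ lam.parts.toFinset, (lam.parts.count j).factorial =
      (lam.parts.count 1).factorial * ∏ j ∈ m.toFinset, (m.count j).factorial := by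
    have h1 : 1 ∉ m.toFinset := by simp [hm]
    rw [Finset.prod_subset (s₂ := insert 1 m.toFinset), Finset.prod_insert h1]
    · congr 1
      refine Finset.prod_congr rfl fun j hj => ?_
      rw [hm, Multiset.count_filter_of_pos]
      simp only [hm, Multiset.mem_toFinset, Multiset.mem_filter] at hj
      exact hj.2
    · intro j hj
      have hj : j ∈ lam.parts := Multiset.mem_toFinset.1 hj
      have := lam.parts_pos hj
      simp only [Finset.mem_insert, Multiset.mem_toFinset, hm, Multiset.mem_filter]
      by_cases h : j = 1
      · exact Or.inl h
      · exact Or.inr ⟨hj, by omega⟩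
    · intro j _ hj
      rw [Multiset.count_eq_zero_of_notMem (fun h => hj (Multiset.mem_toFinset.2 h)),
        Nat.factorial_zero]
  have key := Perm.card_of_cycleType_mul_eq (Fin d) m
  rw [Fintype.card_fin, if_pos ⟨by omega, fun a ha => (Multiset.mem_filter.1 ha).2⟩] at key
  rw [← key, zPart, hcount, hprod, Nat.card_eq_fintype_card, Fintype.card_subtype]
  simp only [hiff]
  have : d - m.sum = lam.parts.count 1 := by omega
  rw [this]
  ring

/-- The full cycle type as a partition. -/
noncomputable def cyclePartition (s : Perm (Fin d)) : Nat.Partition d where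
  parts := fullCycleType s
  parts_pos := fullCycleType_pos s
  parts_sum := (fullCycleType_sum s).trans (Fintype.card_fin d)

lemma exists_cyclePartition_eq (lam : Nat.Partition d) :
    ∃ s : Perm (Fin d), cyclePartition s = lam := by
  have h := card_fullCycleType_mul_zPart lam
  have : Nat.card {s : Perm (Fin d) // fullCycleType s = lam.parts} ≠ 0 := by
    intro h0
    rw [h0, zero_mul] at h
    exact d.factorial_ne_zero h.symm
  obtain ⟨⟨s, hs⟩⟩ := (Nat.card_ne_zero.1 this).1
  exact ⟨s, Nat.Partition.ext hs⟩

/-- The cycles of a permutation have representatives, listed by increasing length. -/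
lemma exists_roots (s : Perm (Fin d)) (lam : Nat.Partition d) (hs : fullCycleType s = lam.parts) :
    ∃ r : Fin (Multiset.card lam.parts) → Fin d,
      (List.ofFn fun i => orbitSize s (r i)) = lam.parts.sort (· ≤ ·) ∧
      (∀ i j, s.SameCycle (r i) (r j) → i = j) ∧ ∀ x, ∃ i, s.SameCycle (r i) x := by
  classical
  have := Fintype.ofFinite (Quot s.SameCycle)
  rw [fullCycleType_eq_map_orbitSize] at hs
  set L := lam.parts.sort (· ≤ ·) with hL
  set U := (Finset.univ : Finset (Quot s.SameCycle)).toList with hU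
  have hperm : (U.map fun q => orbitSize s q.out).Perm L := by
    rw [← Multiset.coe_eq_coe, ← Multiset.map_coe, hU, Finset.coe_toList, hL, Multiset.sort_eq]
    exact hs
  obtain ⟨V, hV, hVL⟩ : ∃ V : List (Quot s.SameCycle), V.Perm U ∧
      V.map (fun q => orbitSize s q.out) = L := by
    obtain ⟨V, h1, h2⟩ := List.perm_comp_forall₂ (r := fun a q => a = orbitSize s q.out)
      (v := U) hperm.symm (by simp [List.forall₂_map_left_iff, List.forall₂_same])
    refine ⟨V, h2, ?_⟩
    rw [← List.forall₂_eq_eq_eq, List.forall₂_map_left_iff]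
    exact h1.flip.imp fun _ _ h => h.symm
  have hlen : V.length = Multiset.card lam.parts := by
    rw [← List.length_map (as := V) (f := fun q => orbitSize s q.out), hVL, hL,
      Multiset.length_sort]
  have hnd : V.Nodup := hV.nodup_iff.2 (Finset.nodup_toList _)
  refine ⟨fun i => (V.get (i.cast hlen.symm)).out, ?_, ?_, ?_⟩
  · rw [← hVL]
    refine List.ext_getElem (by simp [hlen]) fun i h1 h2 => ?_
    simp
  · intro i j hij
    rw [← quot_mk_sameCycle_iff, Quot.out_eq, Quot.out_eq] at hij
    have := hnd.injective_get hij
    exact Fin.cast_injective _ this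
  · intro x
    have : Quot.mk s.SameCycle x ∈ V := hV.mem_iff.2 (by simp [hU])
    obtain ⟨i, hi⟩ := List.mem_iff_get.1 this
    refine ⟨i.cast hlen, ?_⟩
    have h := quot_out_sameCycle s x
    rw [← hi] at h
    exact h

end CycleType

end FSM

namespace FSM

section Automorphisms

variable {m n : ℕ}

lemma HMapData.ext' {M N : HMapData m n} (h0 : M.s0 = N.s0) (h1 : M.s1 = N.s1)
    (h2 : M.s2 = N.s2) (hR : M.R = N.R) : M = N := by
  cases M
  cases N
  simp_all

instance : Finite (HMapData m n) :=
  Finite.of_injective (fun M => (M.s0, M.s1, M.s2, M.R)) fun M N h => by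
    simp only [Prod.mk.injEq] at h
    exact HMapData.ext' h.1 h.2.1 h.2.2.1 h.2.2.2

/-- Relabelling the edges of a hypermap. -/
instance : MulAction (Perm (Fin m)) (HMapData m n) where
  smul φ M :=
    { s0 := φ * M.s0 * φ⁻¹
      s1 := φ * M.s1 * φ⁻¹
      s2 := φ * M.s2 * φ⁻¹
      R := φ ∘ M.R
      rel := by
        have h : φ * (M.s0 * M.s1 * M.s2) * φ⁻¹ = 1 := by rw [M.rel]; simp
        rw [← h]
        group
      roots_distinct := fun i j h => M.roots_distinct i j (by
        simpa [Perm.sameCycle_conj] using h) }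
  one_smul M := HMapData.ext' (by change 1 * M.s0 * 1⁻¹ = _; group)
    (by change 1 * M.s1 * 1⁻¹ = _; group) (by change 1 * M.s2 * 1⁻¹ = _; group) rfl
  mul_smul φ ψ M := HMapData.ext'
    (by change φ * ψ * M.s0 * (φ * ψ)⁻¹ = φ * (ψ * M.s0 * ψ⁻¹) * φ⁻¹; group)
    (by change φ * ψ * M.s1 * (φ * ψ)⁻¹ = φ * (ψ * M.s1 * ψ⁻¹) * φ⁻¹; group)
    (by change φ * ψ * M.s2 * (φ * ψ)⁻¹ = φ * (ψ * M.s2 * ψ⁻¹) * φ⁻¹; group) rfl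

lemma smul_eq_iff {φ : Perm (Fin m)} {M N : HMapData m n} :
    φ • M = N ↔ φ * M.s0 * φ⁻¹ = N.s0 ∧ φ * M.s1 * φ⁻¹ = N.s1 ∧ φ * M.s2 * φ⁻¹ = N.s2 ∧
      ∀ i, φ (M.R i) = N.R i := by
  constructor
  · rintro rfl
    exact ⟨rfl, rfl, rfl, fun _ => rfl⟩
  · rintro ⟨h0, h1, h2, hR⟩
    exact HMapData.ext' h0 h1 h2 (funext hR)

lemma hMapEquivRel_iff {M N : HMapData m n} :
    HMapEquivRel M N ↔ ∃ φ : Perm (Fin m), φ • M = N :=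
  exists_congr fun _ => smul_eq_iff.symm

lemma hAutCard_eq (M : HMapData m n) :
    hAutCard M = Nat.card (MulAction.stabilizer (Perm (Fin m)) M) :=
  Nat.card_congr (Equiv.subtypeEquivRight fun _ => smul_eq_iff.symm)

lemma sameCycle_conj_apply {α : Type*} (φ s : Perm α) (x y : α) :
    (φ * s * φ⁻¹).SameCycle (φ x) (φ y) ↔ s.SameCycle x y := by
  simp [Perm.sameCycle_conj]

lemma orbitSize_conj {α : Type*} (φ s : Perm α) (x : α) :
    orbitSize (φ * s * φ⁻¹) (φ x) = orbitSize s x :=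
  orbitSize_eq_of_sameCycle_iff φ fun y => sameCycle_conj_apply φ s x y

lemma HCond.smul {degs : Multiset ℕ} {a : ℤ} {nf ef : ℕ →₀ ℕ} {fs : Bool} {M : HMapData m n}
    (h : HCond degs a nf ef fs M) (φ : Perm (Fin m)) : HCond degs a nf ef fs (φ • M) := by
  obtain ⟨h1, h2, h3, h4, h5⟩ := h
  refine ⟨?_, ?_, fun i => ?_, fun i => ?_, fun hfs => ?_⟩
  · rw [← h1]
    exact congrArg List.ofFn (funext fun i => orbitSize_conj φ M.s2 (M.R i))
  · rw [← h2]
    change -((cycleCount (φ * M.s0 * φ⁻¹) : ℤ) - m + cycleCount (φ * M.s1 * φ⁻¹) +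
      cycleCount (φ * M.s2 * φ⁻¹) - n) = _
    simp only [cycleCount_conj]
    rfl
  · rw [← h3 i]
    refine (card_quot_sameCycle_congr φ
      (P := fun x => orbitSize M.s2 x = i ∧ ∀ j, ¬ M.s2.SameCycle (M.R j) x)
      (Q := fun x => orbitSize (φ * M.s2 * φ⁻¹) x = i ∧
        ∀ j, ¬ (φ * M.s2 * φ⁻¹).SameCycle (φ (M.R j)) x) ?_ ?_ ?_).symm
    · rintro x y hxy ⟨hx, hx'⟩
      exact ⟨(orbitSize_eq_of_sameCycle hxy).symm.trans hx,
        fun j hj => hx' j (hj.trans hxy.symm)⟩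
    · intro x
      simp only [orbitSize_conj, sameCycle_conj_apply]
    · intro x y _
      exact sameCycle_conj_apply φ M.s2 x y
  · rw [← h4 i]
    refine (card_quot_sameCycle_congr φ (P := fun x => orbitSize M.s1 x = i)
      (Q := fun x => orbitSize (φ * M.s1 * φ⁻¹) x = i) ?_ ?_ ?_).symm
    · exact fun x y hxy hx => (orbitSize_eq_of_sameCycle hxy).symm.trans hx
    · intro x
      rw [orbitSize_conj]
    · intro x y _
      exact sameCycle_conj_apply φ M.s1 x y
  · rintro x y ⟨i, hi⟩ ⟨j, hj⟩ hxy
    obtain ⟨x, rfl⟩ := φ.surjective x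
    obtain ⟨y, rfl⟩ := φ.surjective y
    exact congrArg φ (h5 hfs x y ⟨i, (sameCycle_conj_apply φ M.s2 _ _).1 hi⟩
      ⟨j, (sameCycle_conj_apply φ M.s2 _ _).1 hj⟩ ((sameCycle_conj_apply φ M.s0 _ _).1 hxy))

/-- The weighted count of classes is the count of labelled hypermaps divided by the
number of labellings. -/
lemma factorial_mul_finsum_inv_hAutCard (P : HMapData m n → Prop)
    (hP : ∀ M, P M → ∀ φ : Perm (Fin m), P (φ • M)) :
    (m.factorial : ℚ) *
      ∑ᶠ c : Quot (fun M M' : {M : HMapData m n // P M} => HMapEquivRel M.1 M'.1),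
        (1 : ℚ) / (hAutCard c.out.1 : ℚ) = Nat.card {M : HMapData m n // P M} := by
  set r := fun M M' : {M : HMapData m n // P M} => HMapEquivRel M.1 M'.1 with hr
  have hequiv : Equivalence r := by
    simp only [hr, hMapEquivRel_iff]
    refine ⟨fun M => ⟨1, one_smul _ _⟩, ?_, ?_⟩
    · rintro M N ⟨φ, h⟩
      exact ⟨φ⁻¹, by rw [← h, inv_smul_smul]⟩
    · rintro M N K ⟨φ, h⟩ ⟨ψ, h'⟩
      exact ⟨ψ * φ, by rw [mul_smul, h, h']⟩
  have : Finite (Quot r) := Finite.of_surjective _ Quot.mk_surjective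
  have := Fintype.ofFinite (Quot r)
  rw [finsum_eq_sum_of_fintype, Finset.mul_sum,
    Nat.card_congr (Equiv.sigmaFiberEquiv (Quot.mk r)).symm, Nat.card_sigma, Nat.cast_sum]
  refine Finset.sum_congr rfl fun c _ => ?_
  have horb : Nat.card {M : {M : HMapData m n // P M} // Quot.mk r M = c} =
      Nat.card (MulAction.orbit (Perm (Fin m)) c.out.1) := by
    have hc : ∀ M, Quot.mk r M = c ↔ M.1 ∈ MulAction.orbit (Perm (Fin m)) c.out.1 := by
      intro M
      have h : Quot.mk r M = c ↔ r c.out M := by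
        rw [← hequiv.quot_mk_eq_iff, Quot.out_eq, eq_comm]
      exact h.trans hMapEquivRel_iff
    refine Nat.card_eq_of_bijective (fun M => ⟨M.1.1, (hc _).1 M.2⟩) ⟨fun M N h => ?_, ?_⟩
    · exact Subtype.ext (Subtype.ext (Subtype.mk.inj h))
    · rintro ⟨N, hN⟩
      have hPN : P N := by
        obtain ⟨φ, rfl⟩ := hN
        exact hP _ c.out.2 φ
      exact ⟨⟨⟨N, hPN⟩, (hc _).2 hN⟩, rfl⟩
  have hmul : Nat.card (MulAction.orbit (Perm (Fin m)) c.out.1) * hAutCard c.out.1 =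
      m.factorial := by
    have := Subgroup.card_eq_card_quotient_mul_card_subgroup
      (MulAction.stabilizer (Perm (Fin m)) c.out.1)
    rw [← Nat.card_congr (MulAction.orbitEquivQuotientStabilizer (Perm (Fin m)) c.out.1),
      Nat.card_eq_fintype_card (α := Perm (Fin m)), Fintype.card_perm, Fintype.card_fin] at this
    rw [hAutCard_eq, ← this]
  have hne : (hAutCard c.out.1 : ℚ) ≠ 0 := by
    intro h
    rw [Nat.cast_eq_zero] at h
    rw [h, mul_zero] at hmul
    exact m.factorial_ne_zero hmul.symm
  rw [horb, mul_one_div, div_eq_iff hne, ← Nat.cast_mul, hmul]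

end Automorphisms

end FSM

namespace FSM

section Labelled

variable {m n d : ℕ}

/-- A hypermap whose boundary edges are labelled by `Fin d` so that the face permutation
acts on the labels by `ρ`. -/
structure LabelledMap (m : ℕ) {d : ℕ} (ρ : Perm (Fin d)) where
  s0 : Perm (Fin m)
  s1 : Perm (Fin m)
  s2 : Perm (Fin m)
  f : Fin d ↪ Fin m
  rel : s0 * s1 * s2 = 1
  map_f : ∀ i, s2 (f i) = f (ρ i)

namespace LabelledMap

lemma ext' {ρ : Perm (Fin d)} {L K : LabelledMap m ρ} (h0 : L.s0 = K.s0) (h1 : L.s1 = K.s1)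
    (h2 : L.s2 = K.s2) (hf : L.f = K.f) : L = K := by
  cases L
  cases K
  simp_all

instance (ρ : Perm (Fin d)) : Finite (LabelledMap m ρ) :=
  Finite.of_injective (fun L => (L.s0, L.s1, L.s2, L.f)) fun L K h => by
    simp only [Prod.mk.injEq] at h
    exact ext' h.1 h.2.1 h.2.2.1 h.2.2.2

/-- The analogue of `HCond` for labelled maps. -/
def Cond {ρ : Perm (Fin d)} (a : ℤ) (nf ef : ℕ →₀ ℕ) (fs : Bool) (L : LabelledMap m ρ) : Prop :=
  -((cycleCount L.s0 : ℤ) - m + cycleCount L.s1 +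
    Nat.card {q : Quot L.s2.SameCycle // q.out ∉ Set.range L.f}) = a ∧
  (∀ i, Nat.card {q : Quot L.s2.SameCycle //
    orbitSize L.s2 q.out = i ∧ q.out ∉ Set.range L.f} = nf i) ∧
  (∀ i, Nat.card {q : Quot L.s1.SameCycle // orbitSize L.s1 q.out = i} = ef i) ∧
  (fs = true → ∀ i j, L.s0.SameCycle (L.f i) (L.f j) → i = j)

/-- The hypermap rooted at the edges labelled by `r`. -/
def toHMap {ρ : Perm (Fin d)} (L : LabelledMap m ρ) (r : Fin n → Fin d)
    (hr : ∀ i j, ρ.SameCycle (r i) (r j) → i = j) : HMapData m n where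
  s0 := L.s0
  s1 := L.s1
  s2 := L.s2
  R := fun i => L.f (r i)
  rel := L.rel
  roots_distinct := fun i j h => hr i j ((sameCycle_equivariant L.f.injective L.map_f _ _).1 h)

lemma orbitSize_f {ρ : Perm (Fin d)} (L : LabelledMap m ρ) (x : Fin d) :
    orbitSize L.s2 (L.f x) = orbitSize ρ x := by
  symm
  refine Nat.card_eq_of_bijective
    (fun y => ⟨L.f y.1, (sameCycle_equivariant L.f.injective L.map_f _ _).2 y.2⟩) ⟨?_, ?_⟩
  · intro y z h
    exact Subtype.ext (L.f.injective (Subtype.mk.inj h))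
  · rintro ⟨y, hy⟩
    obtain ⟨y, rfl⟩ := mem_range_of_sameCycle L.map_f hy ⟨x, rfl⟩
    exact ⟨⟨y, (sameCycle_equivariant L.f.injective L.map_f _ _).1 hy⟩, rfl⟩

variable {ρ : Perm (Fin d)} {r : Fin n → Fin d}

lemma mem_range_iff (L : LabelledMap m ρ) (hr : ∀ i j, ρ.SameCycle (r i) (r j) → i = j)
    (hcov : ∀ x, ∃ i, ρ.SameCycle (r i) x) (x : Fin m) :
    x ∈ Set.range L.f ↔ ∃ j, (L.toHMap r hr).s2.SameCycle ((L.toHMap r hr).R j) x := by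
  constructor
  · rintro ⟨y, rfl⟩
    obtain ⟨i, hi⟩ := hcov y
    exact ⟨i, (sameCycle_equivariant L.f.injective L.map_f _ _).2 hi⟩
  · rintro ⟨j, hj⟩
    exact mem_range_of_sameCycle L.map_f hj ⟨_, rfl⟩

end LabelledMap

/-- The faces of a hypermap are its boundary faces and its internal faces. -/
lemma HMapData.cycleCount_s2 (M : HMapData m n) :
    cycleCount M.s2 =
      n + Nat.card {q : Quot M.s2.SameCycle // ∀ j, ¬ M.s2.SameCycle (M.R j) q.out} := by
  have : Finite (Quot M.s2.SameCycle) := Finite.of_surjective _ Quot.mk_surjective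
  suffices h : cycleCount M.s2 = Nat.card (Fin n ⊕
      {q : Quot M.s2.SameCycle // ∀ j, ¬ M.s2.SameCycle (M.R j) q.out}) by
    rw [h, Nat.card_sum, Nat.card_fin]
  symm
  refine Nat.card_eq_of_bijective (Sum.elim (fun i => Quot.mk _ (M.R i)) Subtype.val) ⟨?_, ?_⟩
  · rintro (i | q) (j | q') h
    · simp only [Sum.elim_inl, quot_mk_sameCycle_iff] at h
      rw [M.roots_distinct _ _ h]
    · simp only [Sum.elim_inl, Sum.elim_inr] at h
      exact (q'.2 i (h ▸ (quot_out_sameCycle M.s2 (M.R i)).symm)).elim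
    · simp only [Sum.elim_inl, Sum.elim_inr] at h
      exact (q.2 j (h ▸ (quot_out_sameCycle M.s2 (M.R j)).symm)).elim
    · rw [Subtype.ext h]
  · intro q
    by_cases h : ∀ j, ¬ M.s2.SameCycle (M.R j) q.out
    · exact ⟨Sum.inr ⟨q, h⟩, rfl⟩
    · push Not at h
      obtain ⟨j, hj⟩ := h
      refine ⟨Sum.inl j, ?_⟩
      rw [Sum.elim_inl, ← Quot.out_eq q, quot_mk_sameCycle_iff]
      exact hj

lemma zpow_apply_eq_iff_orbitSize_dvd {α : Type*} [Finite α] (s : Perm α) (x : α) (k l : ℤ) :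
    (s ^ k) x = (s ^ l) x ↔ (orbitSize s x : ℤ) ∣ k - l := by
  have h1 : orbitSize s x = Function.minimalPeriod (s • ·) x := by
    have := Fintype.ofFinite (MulAction.orbit (Subgroup.zpowers s) x)
    rw [MulAction.minimalPeriod_eq_card, ← Nat.card_eq_fintype_card]
    refine Nat.card_congr (Equiv.subtypeEquivRight fun y => ⟨?_, ?_⟩)
    · rintro ⟨k, rfl⟩
      exact ⟨⟨s ^ k, k, rfl⟩, rfl⟩
    · rintro ⟨⟨_, k, rfl⟩, rfl⟩
      exact ⟨k, rfl⟩
  have h2 : (s ^ k) x = (s ^ l) x ↔ (s ^ (k - l)) x = x := by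
    rw [sub_eq_neg_add, zpow_add, Perm.mul_apply, zpow_neg, Perm.inv_eq_iff_eq]
  rw [h2, h1, ← MulAction.zpow_smul_eq_iff_minimalPeriod_dvd]
  rfl

namespace LabelledMap

variable {ρ : Perm (Fin d)} {r : Fin n → Fin d}

/-- A hypermap whose boundary degrees match the cycles of `ρ` has exactly one labelling
compatible with its roots. -/
lemma existsUnique_toHMap (hr : ∀ i j, ρ.SameCycle (r i) (r j) → i = j)
    (hcov : ∀ x, ∃ i, ρ.SameCycle (r i) x) (M : HMapData m n)
    (hM : ∀ i, orbitSize M.s2 (M.R i) = orbitSize ρ (r i)) :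
    ∃! L : LabelledMap m ρ, L.toHMap r hr = M := by
  choose c k hk using hcov
  have wd : ∀ x i (l : ℤ), (ρ ^ l) (r i) = x → (M.s2 ^ (k x)) (M.R (c x)) = (M.s2 ^ l) (M.R i) := by
    rintro x i l h
    obtain rfl : c x = i := hr _ _ ⟨k x - l, by
      rw [sub_eq_neg_add, zpow_add, Perm.mul_apply, hk, zpow_neg, Perm.inv_eq_iff_eq, h]⟩
    rw [zpow_apply_eq_iff_orbitSize_dvd, hM, ← zpow_apply_eq_iff_orbitSize_dvd, hk, h]
  refine ⟨⟨M.s0, M.s1, M.s2, ⟨fun x => (M.s2 ^ (k x)) (M.R (c x)), ?_⟩, M.rel, ?_⟩, ?_, ?_⟩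
  · intro x y h
    have h' : (M.s2 ^ (k x)) (M.R (c x)) = (M.s2 ^ (k y)) (M.R (c y)) := h
    have hc : c x = c y := M.roots_distinct _ _ (by
      rw [← Perm.sameCycle_zpow_left (n := k x), h', Perm.sameCycle_zpow_left])
    rw [← hk x, ← hk y, ← hc, zpow_apply_eq_iff_orbitSize_dvd, ← hM,
      ← zpow_apply_eq_iff_orbitSize_dvd, h', hc]
  · intro x
    have := wd (ρ x) (c x) (1 + k x) (by rw [zpow_add, Perm.mul_apply, hk, zpow_one])
    rw [zpow_add, Perm.mul_apply, zpow_one] at this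
    exact this.symm
  · refine HMapData.ext' rfl rfl rfl (funext fun i => ?_)
    exact (wd (r i) i 0 (by simp)).trans (by simp)
  · rintro L rfl
    refine LabelledMap.ext' rfl rfl rfl ?_
    ext x : 1
    change L.f x = (L.s2 ^ (k x)) (L.f (r (c x)))
    rw [zpow_equivariant L.map_f, hk]

lemma hCond_toHMap_iff (L : LabelledMap m ρ) (hr : ∀ i j, ρ.SameCycle (r i) (r j) → i = j)
    (hcov : ∀ x, ∃ i, ρ.SameCycle (r i) x) {degs : Multiset ℕ}
    (hdeg : (List.ofFn fun i => orbitSize ρ (r i)) = degs.sort (· ≤ ·))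
    (a : ℤ) (nf ef : ℕ →₀ ℕ) (fs : Bool) :
    HCond degs a nf ef fs (L.toHMap r hr) ↔ L.Cond a nf ef fs := by
  have hmem : ∀ x, (∀ j, ¬ (L.toHMap r hr).s2.SameCycle ((L.toHMap r hr).R j) x) ↔
      x ∉ Set.range L.f := fun x => by
    rw [L.mem_range_iff hr hcov, not_exists]
  have hb : (L.toHMap r hr).boundaryDegrees = degs.sort (· ≤ ·) := by
    rw [← hdeg]
    exact congrArg List.ofFn (funext fun i => L.orbitSize_f (r i))
  rw [HCond, and_iff_right hb, Cond]
  refine and_congr ?_ (and_congr (forall_congr' fun i => ?_) (and_congr Iff.rfl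
    (imp_congr Iff.rfl ?_)))
  · rw [HMapData.eulerChar, HMapData.cycleCount_s2]
    simp only [hmem]
    change -((cycleCount L.s0 : ℤ) - m + cycleCount L.s1 + ((n +
      Nat.card {q : Quot L.s2.SameCycle // q.out ∉ Set.range L.f} : ℕ) : ℤ) - n) = a ↔ _
    rw [Nat.cast_add, add_sub_assoc, add_sub_cancel_left]
  · rw [HMapData.internalCount]
    simp only [hmem]
    rfl
  · rw [HMapData.FullySimple]
    simp only [← L.mem_range_iff hr hcov]
    constructor
    · intro h i j hij
      exact L.f.injective (h _ _ ⟨i, rfl⟩ ⟨j, rfl⟩ hij)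
    · rintro h _ _ ⟨i, rfl⟩ ⟨j, rfl⟩ hij
      rw [h i j hij]

/-- Rooted hypermaps with boundary degrees `lam` are equinumerous with labelled maps, for
any permutation of cycle type `lam`. -/
lemma card_hCond_eq (ρ : Perm (Fin d)) (lam : Nat.Partition d) (hρ : cyclePartition ρ = lam)
    (a : ℤ) (nf ef : ℕ →₀ ℕ) (fs : Bool) :
    Nat.card {M : HMapData m (Multiset.card lam.parts) // HCond lam.parts a nf ef fs M} =
      Nat.card {L : LabelledMap m ρ // L.Cond a nf ef fs} := by
  obtain ⟨r, hdeg, hr, hcov⟩ := exists_roots ρ lam (congrArg Nat.Partition.parts hρ)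
  symm
  refine Nat.card_eq_of_bijective (fun L => ⟨L.1.toHMap r hr,
    (L.1.hCond_toHMap_iff hr hcov hdeg a nf ef fs).2 L.2⟩) ⟨?_, ?_⟩
  · intro L K h
    have h' : L.1.toHMap r hr = K.1.toHMap r hr := Subtype.mk.inj h
    refine Subtype.ext ((existsUnique_toHMap hr hcov (K.1.toHMap r hr)
      fun i => K.1.orbitSize_f (r i)).unique h' rfl)
  · rintro ⟨M, hM⟩
    have hd : ∀ i, orbitSize M.s2 (M.R i) = orbitSize ρ (r i) := by
      have := hM.1.trans hdeg.symm
      exact congrFun (List.ofFn_injective this)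
    obtain ⟨L, rfl, -⟩ := existsUnique_toHMap hr hcov M hd
    exact ⟨⟨L, (L.hCond_toHMap_iff hr hcov hdeg a nf ef fs).1 hM⟩, rfl⟩

end LabelledMap

end Labelled

end FSM

namespace FSM

section Resolution

/-- The permutations of the range of `f` act on the cycles of `s` so that some
representative has all points of the range in distinct cycles. -/
lemma exists_viaEmbedding_inv_mul {α β : Type*} [Finite α] [Finite β] (f : α ↪ β) (s : Perm β) :
    ∃ π : Perm α, ∀ i j, (π⁻¹.viaEmbedding f * s).SameCycle (f i) (f j) → i = j := by
  classical
  have hex : ∀ i, ∃ n : ℕ, 0 < n ∧ (s ^ n) (f i) ∈ Set.range f := fun i =>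
    ⟨orderOf s, orderOf_pos s, i, by rw [pow_orderOf_eq_one, Perm.one_apply]⟩
  let n : α → ℕ := fun i => Nat.find (hex i)
  have hpos : ∀ i, 0 < n i := fun i => (Nat.find_spec (hex i)).1
  have hmin : ∀ i k, 0 < k → k < n i → (s ^ k) (f i) ∉ Set.range f := fun i k h0 hk hr =>
    Nat.find_min (hex i) hk ⟨h0, hr⟩
  choose p hp using fun i => (Nat.find_spec (hex i)).2
  have hinj : Function.Injective p := by
    have key : ∀ i j, n i ≤ n j → p i = p j → i = j := by
      intro i j hle hij
      have h1 : (s ^ n i) (f i) = (s ^ n j) (f j) := by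
        rw [← hp i, ← hp j, hij]
      rw [← Nat.add_sub_cancel' hle, pow_add, Perm.mul_apply,
        (s ^ n i).injective.eq_iff] at h1
      rcases Nat.eq_zero_or_pos (n j - n i) with h0 | h0
      · rw [h0, pow_zero, Perm.one_apply] at h1
        exact f.injective h1
      · exact (hmin j _ h0 (Nat.sub_lt (hpos j) (hpos i)) ⟨i, h1⟩).elim
    intro i j hij
    rcases le_total (n i) (n j) with h | h
    · exact key i j h hij
    · exact (key j i h hij.symm).symm
  let π : Perm α := Equiv.ofBijective p (Finite.injective_iff_bijective.1 hinj)
  have hπ : ∀ i, f (π i) = (s ^ n i) (f i) := hp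
  refine ⟨π, fun i j hij => ?_⟩
  obtain ⟨k, hk⟩ := hij.exists_nat_pow_eq
  have hstep : ∀ k : ℕ, ∃ l < n i, ((π⁻¹.viaEmbedding f * s) ^ k) (f i) = (s ^ l) (f i) := by
    intro k
    induction k with
    | zero => exact ⟨0, hpos i, rfl⟩
    | succ k ih =>
      obtain ⟨l, hl, hkl⟩ := ih
      rw [pow_succ', Perm.mul_apply, hkl, Perm.mul_apply, ← Perm.mul_apply s, ← pow_succ']
      rcases Nat.lt_or_ge (l + 1) (n i) with h | h
      · exact ⟨l + 1, h, Perm.viaEmbedding_apply_of_notMem _ _ _ (hmin i _ l.succ_pos h)⟩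
      · refine ⟨0, hpos i, ?_⟩
        rw [show l + 1 = n i by omega, ← hπ, Perm.viaEmbedding_apply, ← Perm.mul_apply,
          inv_mul_cancel, Perm.one_apply, pow_zero, Perm.one_apply]
  obtain ⟨l, hl, hkl⟩ := hstep k
  rw [hk] at hkl
  rcases Nat.eq_zero_or_pos l with rfl | h0
  · exact (f.injective hkl).symm
  · exact (hmin i l h0 hl ⟨j, hkl⟩).elim

/-- Permutations that preserve a set and agree off it have the same cycles off it. -/
lemma sameCycle_iff_of_eqOn_compl {β : Type*} [Finite β] {s t : Perm β} {A : Set β}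
    (hs : ∀ x y, s.SameCycle x y → x ∈ A → y ∈ A) (h : ∀ x ∉ A, s x = t x) {x y : β}
    (hx : x ∉ A) : t.SameCycle x y ↔ s.SameCycle x y := by
  have hpow : ∀ k : ℕ, (t ^ k) x = (s ^ k) x := by
    intro k
    induction k with
    | zero => rfl
    | succ k ih =>
      rw [pow_succ', Perm.mul_apply, ih, pow_succ', Perm.mul_apply, h]
      exact fun hm => hx (hs _ _ (Perm.SameCycle.symm ⟨k, rfl⟩) hm)
  constructor
  · intro hxy
    obtain ⟨k, rfl⟩ := hxy.exists_nat_pow_eq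
    exact ⟨k, (hpow k).symm⟩
  · intro hxy
    obtain ⟨k, rfl⟩ := hxy.exists_nat_pow_eq
    exact ⟨k, hpow k⟩

namespace LabelledMap

variable {m d : ℕ} {ρ π : Perm (Fin d)}

/-- Multiplying the vertex permutation by a permutation of the boundary edges. -/
noncomputable def twist (L : LabelledMap m (ρ * π)) : LabelledMap m ρ where
  s0 := π.viaEmbedding L.f * L.s0
  s1 := L.s1
  s2 := L.s2 * π⁻¹.viaEmbedding L.f
  f := L.f
  rel := by
    rw [← Perm.viaEmbeddingHom_apply, ← Perm.viaEmbeddingHom_apply, map_inv, ← mul_assoc,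
      mul_inv_eq_one, mul_assoc, mul_assoc, ← mul_assoc L.s0, L.rel, mul_one]
  map_f := fun i => by
    rw [Perm.mul_apply, Perm.viaEmbedding_apply, L.map_f, Perm.mul_apply, ← Perm.mul_apply π,
      mul_inv_cancel, Perm.one_apply]

lemma exists_twist_eq (K : LabelledMap m ρ) (π : Perm (Fin d)) :
    ∃ L : LabelledMap m (ρ * π), L.twist = K ∧ L.s0 = π⁻¹.viaEmbedding K.f * K.s0 ∧ L.f = K.f := by
  refine ⟨⟨π⁻¹.viaEmbedding K.f * K.s0, K.s1, K.s2 * π.viaEmbedding K.f, K.f, ?_, fun i => ?_⟩,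
    ext' ?_ rfl ?_ rfl, rfl, rfl⟩
  · rw [← Perm.viaEmbeddingHom_apply, ← Perm.viaEmbeddingHom_apply, map_inv, mul_assoc,
      mul_assoc, inv_mul_eq_one, ← mul_assoc, ← mul_assoc, K.rel, one_mul]
  · rw [Perm.mul_apply, Perm.viaEmbedding_apply, K.map_f, Perm.mul_apply]
  · change π.viaEmbedding K.f * (π⁻¹.viaEmbedding K.f * K.s0) = K.s0
    rw [← Perm.viaEmbeddingHom_apply, ← Perm.viaEmbeddingHom_apply, map_inv, mul_inv_cancel_left]
  · change K.s2 * π.viaEmbedding K.f * π⁻¹.viaEmbedding K.f = K.s2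
    rw [← Perm.viaEmbeddingHom_apply, ← Perm.viaEmbeddingHom_apply, map_inv, mul_inv_cancel_right]

lemma twist_cond_iff (L : LabelledMap m (ρ * π))
    (hL : ∀ i j, L.s0.SameCycle (L.f i) (L.f j) → i = j) (a : ℤ) (nf ef : ℕ →₀ ℕ) :
    L.twist.Cond a nf ef false ↔ L.Cond (a - (d - cycleCount π)) nf ef true := by
  have hsame : ∀ x y, x ∉ Set.range L.f →
      (L.twist.s2.SameCycle x y ↔ L.s2.SameCycle x y) := fun x y hx =>
    sameCycle_iff_of_eqOn_compl (fun x y => mem_range_of_sameCycle L.map_f)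
      (fun x hx => show L.s2 x = L.s2 (π⁻¹.viaEmbedding L.f x) by
        rw [Perm.viaEmbedding_apply_of_notMem _ _ _ hx]) hx
  have hmem : ∀ x y, L.s2.SameCycle x y → x ∉ Set.range L.f → y ∉ Set.range L.f :=
    fun x y h hx hy => hx (mem_range_of_sameCycle L.map_f h.symm hy)
  have hsize : ∀ x, x ∉ Set.range L.f → orbitSize L.twist.s2 x = orbitSize L.s2 x := fun x hx =>
    Nat.card_congr (Equiv.subtypeEquivRight fun y => hsame x y hx)
  have hfaces : Nat.card {q : Quot L.twist.s2.SameCycle // q.out ∉ Set.range L.twist.f} =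
      Nat.card {q : Quot L.s2.SameCycle // q.out ∉ Set.range L.f} :=
    (card_quot_sameCycle_congr (Equiv.refl _) (t := L.twist.s2) (P := fun x => x ∉ Set.range L.f)
      (Q := fun x => x ∉ Set.range L.twist.f) hmem (fun x => Iff.rfl) hsame).symm
  have hfaces' : ∀ i, Nat.card {q : Quot L.twist.s2.SameCycle //
        orbitSize L.twist.s2 q.out = i ∧ q.out ∉ Set.range L.twist.f} =
      Nat.card {q : Quot L.s2.SameCycle // orbitSize L.s2 q.out = i ∧ q.out ∉ Set.range L.f} :=
    fun i => (card_quot_sameCycle_congr (Equiv.refl _) (t := L.twist.s2)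
      (P := fun x => orbitSize L.s2 x = i ∧ x ∉ Set.range L.f)
      (Q := fun x => orbitSize L.twist.s2 x = i ∧ x ∉ Set.range L.twist.f)
      (fun x y h hx => ⟨(orbitSize_eq_of_sameCycle h).symm.trans hx.1, hmem x y h hx.2⟩)
      (fun x => and_congr_left fun hx => by rw [Equiv.refl_apply, hsize x hx])
      (fun x y hx => hsame x y hx.2)).symm
  have hcount : cycleCount L.twist.s0 + d = cycleCount L.s0 + cycleCount π := by
    have := cycleCount_viaEmbedding_mul L.f π L.s0 hL
    rwa [Nat.card_fin] at this
  rw [Cond, Cond, hfaces]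
  refine and_congr ?_ (and_congr (forall_congr' fun i => by rw [hfaces']) (and_congr Iff.rfl ?_))
  · change -((cycleCount L.twist.s0 : ℤ) - m + cycleCount L.s1 + _) = a ↔ _
    constructor <;> intro h <;> omega
  · exact iff_of_true (fun h => by cases h) (fun _ => hL)

/-- Every labelled map is obtained by twisting from exactly one fully simple one. -/
lemma card_cond_eq_sum (m : ℕ) (ρ : Perm (Fin d)) (a : ℤ) (nf ef : ℕ →₀ ℕ) :
    Nat.card {L : LabelledMap m ρ // L.Cond a nf ef false} =
      ∑ π : Perm (Fin d), Nat.card {L : LabelledMap m (ρ * π) //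
        L.Cond (a - (d - cycleCount π)) nf ef true} := by
  rw [← Nat.card_sigma]
  symm
  refine Nat.card_eq_of_bijective (fun L => ⟨L.2.1.twist,
    (L.2.1.twist_cond_iff (L.2.2.2.2.2 rfl) a nf ef).2 L.2.2⟩) ⟨?_, ?_⟩
  · rintro ⟨π, L, hL⟩ ⟨τ, K, hK⟩ h
    have h : L.twist = K.twist := Subtype.mk.inj h
    have hf : L.f = K.f := congrArg LabelledMap.f h
    have h0 : π.viaEmbedding L.f * L.s0 = τ.viaEmbedding K.f * K.s0 := congrArg LabelledMap.s0 h
    have h1 : L.s1 = K.s1 := congrArg LabelledMap.s1 h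
    have h2 : L.s2 * π⁻¹.viaEmbedding L.f = K.s2 * τ⁻¹.viaEmbedding K.f :=
      congrArg LabelledMap.s2 h
    have hs0 : K.s0 = (τ⁻¹ * π).viaEmbedding L.f * L.s0 := by
      simp only [← Perm.viaEmbeddingHom_apply, map_mul, map_inv] at h0 ⊢
      rw [mul_assoc, h0, hf, inv_mul_cancel_left]
    have hπ : π = τ := by
      have key := (sameCycle_viaEmbedding_mul L.f (τ⁻¹ * π) L.s0 (hL.2.2.2 rfl)).2.1
      rw [← hs0, hf] at key
      refine (inv_mul_eq_one.1 (Equiv.ext fun i => ?_)).symm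
      exact (hK.2.2.2 rfl _ _ (key _ _
        (Perm.sameCycle_apply_right.2 (Perm.SameCycle.refl _ i)))).symm
    subst hπ
    rw [hf] at h0 h2
    congr 2
    exact ext' (mul_left_cancel h0) h1 (mul_right_cancel h2) hf
  · rintro ⟨K, hK⟩
    obtain ⟨π, hπ⟩ := exists_viaEmbedding_inv_mul K.f K.s0
    obtain ⟨L, rfl, h0, hf⟩ := K.exists_twist_eq π
    rw [← h0] at hπ
    exact ⟨⟨π, L, (L.twist_cond_iff hπ a nf ef).1 hK⟩, rfl⟩

end LabelledMap

end Resolution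

end FSM

namespace FSM

section Assembly

variable {d : ℕ}

/-- Up to the factor `z(λ)`, strictly monotone Hurwitz numbers count the permutations that
turn a given permutation of cycle type `λ` into one of cycle type `μ`. -/
lemma zPart_mul_Hstrict (k : ℕ) (ρ : Perm (Fin d)) (mu : Nat.Partition d) :
    (zPart (cyclePartition ρ) : ℚ) * Hstrict d k (cyclePartition ρ) mu =
      Nat.card {π : Perm (Fin d) // cyclePartition (ρ * π) = mu ∧ k + cycleCount π = d} := by
  have hg : ∀ s : {s : Perm (Fin d) // fullCycleType s = (cyclePartition ρ).parts},
      ∃ g : Perm (Fin d), g * ρ * g⁻¹ = s.1 := fun s =>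
    isConj_iff.1 (fullCycleType_eq_iff_isConj.1 s.2.symm)
  choose g hg using hg
  choose l hl using fun π : Perm (Fin d) => (existsUnique_isStrictlyMonotone π).exists
  have hlen : ∀ π : Perm (Fin d), (l π).length + cycleCount π = d := fun π => by
    have := (hl π).1.length_add_cycleCount
    rwa [(hl π).2] at this
  have hconj : ∀ s π, s.1 * (g s * π * (g s)⁻¹) = g s * (ρ * π) * (g s)⁻¹ := fun s π => by
    rw [← hg s]
    group
  have hcard : Nat.card {t : Perm (Fin d) × List (Perm (Fin d)) × Perm (Fin d) //
        fullCycleType t.1 = (cyclePartition ρ).parts ∧ fullCycleType t.2.2 = mu.parts ∧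
        t.2.1.length = k ∧ IsStrictlyMonotone t.2.1 ∧ t.1 * t.2.1.prod * t.2.2 = 1} =
      Nat.card {s : Perm (Fin d) // fullCycleType s = (cyclePartition ρ).parts} *
        Nat.card {π : Perm (Fin d) // cyclePartition (ρ * π) = mu ∧ k + cycleCount π = d} := by
    rw [← Nat.card_prod]
    symm
    refine Nat.card_eq_of_bijective (fun p => ⟨(p.1.1, l (g p.1 * p.2.1 * (g p.1)⁻¹),
      (p.1.1 * (g p.1 * p.2.1 * (g p.1)⁻¹))⁻¹), p.1.2, ?_, ?_, (hl _).1, ?_⟩) ⟨?_, ?_⟩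
    · rw [fullCycleType_inv, hconj, fullCycleType_conj]
      exact congrArg Nat.Partition.parts p.2.2.1
    · have h1 := hlen (g p.1 * p.2.1 * (g p.1)⁻¹)
      have h2 := p.2.2.2
      rw [cycleCount_conj] at h1
      exact Nat.add_right_cancel (h1.trans h2.symm)
    · rw [(hl _).2, mul_inv_cancel]
    · rintro ⟨s, π⟩ ⟨s', π'⟩ h
      simp only [Subtype.mk.injEq, Prod.mk.injEq] at h
      obtain rfl := Subtype.ext h.1
      have h1 := h.2.2
      rw [inv_inj, mul_right_inj, mul_left_inj, mul_right_inj] at h1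
      rw [Subtype.ext h1]
    · rintro ⟨⟨s, L, t⟩, h1, h2, h3, h4, h5⟩
      simp only at h1 h2 h3 h4 h5
      have ht : t = (s * L.prod)⁻¹ := eq_inv_of_mul_eq_one_right h5
      subst ht
      have hπ : g ⟨s, h1⟩ * ((g ⟨s, h1⟩)⁻¹ * L.prod * g ⟨s, h1⟩) * (g ⟨s, h1⟩)⁻¹ = L.prod := by
        group
      refine ⟨⟨⟨s, h1⟩, (g ⟨s, h1⟩)⁻¹ * L.prod * g ⟨s, h1⟩, ?_, ?_⟩, ?_⟩
      · refine Nat.Partition.ext ?_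
        rw [← h2, fullCycleType_inv]
        change fullCycleType _ = _
        rw [← fullCycleType_conj (g ⟨s, h1⟩), ← hconj, hπ]
      · have := h4.length_add_cycleCount
        rwa [h3, ← hπ, cycleCount_conj] at this
      · refine Subtype.ext ?_
        simp only [hπ, Prod.mk.injEq, true_and, and_true]
        exact (existsUnique_isStrictlyMonotone L.prod).unique (hl _) ⟨h4, rfl⟩
  have hz := card_fullCycleType_mul_zPart (cyclePartition ρ)
  rw [Hstrict, hcard, ← mul_div_assoc, div_eq_iff (Nat.cast_ne_zero.2 d.factorial_ne_zero), ← hz]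
  push_cast
  ring

lemma Hstrict_eq_zero_of_lt {k : ℕ} (hk : d < k) (lam mu : Nat.Partition d) :
    Hstrict d k lam mu = 0 := by
  obtain ⟨ρ, rfl⟩ := exists_cyclePartition_eq lam
  have hz : (zPart (cyclePartition ρ) : ℚ) ≠ 0 := fun h0 => by
    have := card_fullCycleType_mul_zPart (cyclePartition ρ)
    rw [Nat.cast_eq_zero.1 h0, mul_zero] at this
    exact d.factorial_ne_zero this.symm
  have : IsEmpty {π : Perm (Fin d) // cyclePartition (ρ * π) = mu ∧ k + cycleCount π = d} :=
    ⟨fun π => by have := π.2.2; omega⟩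
  have h := zPart_mul_Hstrict k ρ mu
  rw [Nat.card_of_isEmpty, Nat.cast_zero] at h
  exact (mul_eq_zero.1 h).resolve_left hz

lemma factorial_mul_hMapEnum (ρ : Perm (Fin d)) (a : ℤ) (nf ef : ℕ →₀ ℕ) (fs : Bool) :
    ((d + nf.sum fun i k => i * k).factorial : ℚ) * hMapEnum d (cyclePartition ρ) a nf ef fs =
      Nat.card {L : LabelledMap (d + nf.sum fun i k => i * k) ρ // L.Cond a nf ef fs} := by
  rw [← LabelledMap.card_hCond_eq ρ _ rfl]
  exact factorial_mul_finsum_inv_hAutCard _ fun M hM φ => hM.smul φ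

lemma hMapEnum_eq_sum (ρ : Perm (Fin d)) (a : ℤ) (nf ef : ℕ →₀ ℕ) :
    hMapEnum d (cyclePartition ρ) a nf ef false = ∑ π : Perm (Fin d),
      hMapEnum d (cyclePartition (ρ * π)) (a - (d - cycleCount π)) nf ef true := by
  refine mul_left_cancel₀ (Nat.cast_ne_zero.2
    (d + nf.sum fun i k => i * k).factorial_ne_zero : (_ : ℚ) ≠ 0) ?_
  simp only [Finset.mul_sum, factorial_mul_hMapEnum]
  rw [LabelledMap.card_cond_eq_sum, Nat.cast_sum]

end Assembly

end FSM

open FSM in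
/-- **Ordinary hypermaps from fully simple hypermaps via strictly monotone Hurwitz
numbers.**  For a partition `λ ⊢ d`, an integer `a` and finitely supported functions
`n, e` (supported on `{1, 2, 3, …}`) prescribing the internal face degrees and the
hyperedge degrees, `Ord^h(λ; a, n, e) = z(λ) · Σ_{μ ⊢ d} Σ_{k ≥ 0} H^<_k(λ; μ) ·
FS^h(μ; a - k, n, e)`, and for each `μ` the inner sum over `k` has only finitely many
nonzero terms. -/
theorem ordinary_hypermap_eq_strictMonotone_sum_fullySimple
    (d : ℕ) (hd : 0 < d) (lam : Nat.Partition d) (a : ℤ) (nf ef : ℕ →₀ ℕ)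
    (hnf : nf 0 = 0) (hef : ef 0 = 0) :
    (∀ mu : Nat.Partition d,
      (Function.support fun k : ℕ =>
        Hstrict d k lam mu * hMapEnum d mu (a - k) nf ef true).Finite) ∧
    hMapEnum d lam a nf ef false =
      (zPart lam : ℚ) * ∑ mu : Nat.Partition d, ∑ᶠ k : ℕ,
        Hstrict d k lam mu * hMapEnum d mu (a - k) nf ef true := by
  have hsupp : ∀ mu : Nat.Partition d, (Function.support fun k : ℕ =>
      Hstrict d k lam mu * hMapEnum d mu (a - k) nf ef true) ⊆ Finset.range (d + 1) := by
    intro mu k hk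
    rw [Finset.coe_range, Set.mem_Iio, Nat.lt_succ_iff]
    by_contra! h
    exact hk (mul_eq_zero_of_left (Hstrict_eq_zero_of_lt h _ _) _)
  refine ⟨fun mu => (Finset.finite_toSet _).subset (hsupp mu), ?_⟩
  classical
  obtain ⟨ρ, rfl⟩ := exists_cyclePartition_eq lam
  have hterm : ∀ (mu : Nat.Partition d) (k : ℕ), (zPart (cyclePartition ρ) : ℚ) *
      (Hstrict d k (cyclePartition ρ) mu * hMapEnum d mu (a - k) nf ef true) =
      ∑ π : Perm (Fin d), if cyclePartition (ρ * π) = mu ∧ k + cycleCount π = d then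
        hMapEnum d mu (a - k) nf ef true else 0 := by
    intro mu k
    rw [← mul_assoc, zPart_mul_Hstrict, ← Finset.sum_filter, Finset.sum_const, nsmul_eq_mul,
      Nat.card_eq_fintype_card, Fintype.card_subtype]
  simp only [finsum_eq_sum_of_support_subset _ (hsupp _), Finset.mul_sum, hterm]
  rw [hMapEnum_eq_sum, Finset.sum_congr rfl fun mu _ => Finset.sum_comm, Finset.sum_comm]
  refine Finset.sum_congr rfl fun π _ => ?_
  have hle := cycleCount_le π
  rw [Nat.card_fin] at hle
  rw [Finset.sum_eq_single (cyclePartition (ρ * π)), Finset.sum_eq_single (d - cycleCount π),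
    if_pos ⟨rfl, Nat.sub_add_cancel hle⟩, Nat.cast_sub hle]
  · exact fun k _ hk => if_neg fun h => hk (by omega)
  · exact fun h => absurd (Finset.mem_range.2 (by omega)) h
  · exact fun mu _ hmu => Finset.sum_eq_zero fun k _ => if_neg fun h => hmu h.1.symm
  · exact fun h => absurd (Finset.mem_univ _) h
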